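/- Let Q(x) = Π(x) − li(x), R(x) = ψ(x) − x, and R₁(x) = ∫_2^x R(t) dt. Then for all real x ≥ 3000, Q(x) = R(x)/log x + R₁(x)/(x·log²x) + ∫_{3000}^x (R₁(t)/(t²·log²t) + 2R₁(t)/(t²·log³t)) dt + C, where C = Q(3000) − R(3000)/log(3000) − R₁(3000)/(3000·log²(3000)). -/

import Mathlib

open MeasureTheory Filter

/-- `PiR x = ∑_{p^m ≤ x} 1/m`, the Riemann prime-counting function
(sum over prime powers `p^m ≤ x` with `m ≥ 1`). -/
noncomputable def PiR (x : ℝ) : ℝ :=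
  ∑ n ∈ Finset.Icc 1 ⌊x⌋₊,
    if IsPrimePow n then (1 : ℝ) / (n.factorization n.minFac) else 0

/-- `psi x = ∑_{p^m ≤ x} log p`, the Chebyshev psi function. -/
noncomputable def psi (x : ℝ) : ℝ :=
  ∑ n ∈ Finset.Icc 1 ⌊x⌋₊, ArithmeticFunction.vonMangoldt n

/-- `li x` is the logarithmic integral, defined for `x > 1` as the Cauchy principal value
`lim_{ε→0⁺} (∫_0^{1-ε} du/log u + ∫_{1+ε}^x du/log u)`. -/
noncomputable def li (x : ℝ) : ℝ :=
  limUnder (nhdsWithin (0:ℝ) (Set.Ioi 0)) (fun ε =>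
    (∫ u in (0:ℝ)..(1 - ε), 1 / Real.log u) + ∫ u in (1 + ε)..x, 1 / Real.log u)

/-- `Q x = Π(x) - li(x)`. -/
noncomputable def Q (x : ℝ) : ℝ := PiR x - li x

/-- `R x = ψ(x) - x`. -/
noncomputable def R (x : ℝ) : ℝ := psi x - x

/-- `R₁ x = ∫_2^x R(t) dt`. -/
noncomputable def R1 (x : ℝ) : ℝ := ∫ t in (2:ℝ)..x, R t

/-- The constant `C = Q(3000) - R(3000)/log 3000 - R₁(3000)/(3000 log² 3000)`. -/
noncomputable def Cconst : ℝ :=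
  Q 3000 - R 3000 / Real.log 3000 - R1 3000 / (3000 * (Real.log 3000) ^ 2)

/-- `1/log u - 1/(u-1)`, cut off to positive `u`; it takes values in `[0,1]`. -/
noncomputable def hreg (u : ℝ) : ℝ := if 0 < u then 1 / Real.log u - 1 / (u - 1) else 0

lemma hreg_bound (u : ℝ) : 0 ≤ hreg u ∧ hreg u ≤ 1 := by
  unfold hreg
  split_ifs with hu
  · rcases lt_trichotomy u 1 with h | h | h
    · have h1 : Real.log u ≤ u - 1 := Real.log_le_sub_one_of_pos hu
      have h2 := Real.one_sub_inv_le_log_of_pos hu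
      have h3 : Real.log u < 0 := Real.log_neg hu h
      have h5 : u - 1 < 0 := by linarith
      have h4 : u - 1 ≤ u * Real.log u := by
        have := mul_le_mul_of_nonneg_left h2 hu.le
        rw [mul_sub, mul_inv_cancel₀ hu.ne'] at this
        linarith
      have e : 1 / Real.log u - 1 / (u - 1)
          = (u - 1 - Real.log u) / (Real.log u * (u - 1)) := by
        rw [div_sub_div _ _ h3.ne h5.ne]; ring
      have hp : 0 < Real.log u * (u - 1) := mul_pos_of_neg_of_neg h3 h5
      rw [e]
      refine ⟨div_nonneg (by linarith) hp.le, ?_⟩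
      rw [div_le_one hp]; nlinarith
    · subst h; simp
    · have h1 : Real.log u ≤ u - 1 := Real.log_le_sub_one_of_pos hu
      have h2 := Real.one_sub_inv_le_log_of_pos hu
      have h3 : 0 < Real.log u := Real.log_pos h
      have h5 : 0 < u - 1 := by linarith
      have h4 : u - 1 ≤ u * Real.log u := by
        have := mul_le_mul_of_nonneg_left h2 hu.le
        rw [mul_sub, mul_inv_cancel₀ hu.ne'] at this
        linarith
      have e : 1 / Real.log u - 1 / (u - 1)
          = (u - 1 - Real.log u) / (Real.log u * (u - 1)) := by
        field_simp
      have hp : 0 < Real.log u * (u - 1) := mul_pos h3 h5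
      rw [e]
      refine ⟨div_nonneg (by linarith) hp.le, ?_⟩
      rw [div_le_one hp]; nlinarith
  · simp

lemma hreg_meas : Measurable hreg := by
  unfold hreg
  refine Measurable.ite measurableSet_Ioi ?_ measurable_const
  have := Real.measurable_log
  fun_prop

lemma hreg_int (a b : ℝ) : IntervalIntegrable hreg volume a b := by
  refine (intervalIntegrable_const (c := (1:ℝ))).mono_fun
    hreg_meas.aestronglyMeasurable ?_
  refine Eventually.of_forall fun u => ?_
  obtain ⟨h0, h1⟩ := hreg_bound u
  simp [abs_of_nonneg h0, h1]

lemma integral_recip_log {a b : ℝ} (ha : 0 ≤ a) (hab : a ≤ b) (h1 : (1:ℝ) ∉ Set.uIcc a b) :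
    ∫ u in a..b, 1 / Real.log u = (∫ u in a..b, hreg u) + Real.log ((b - 1) / (a - 1)) := by
  have h0 : (0:ℝ) ∉ Set.uIcc (a - 1) (b - 1) := by
    rw [Set.uIcc_of_le (by linarith)]
    rw [Set.uIcc_of_le hab] at h1
    intro h
    exact h1 ⟨by linarith [h.1], by linarith [h.2]⟩
  have e2 : ∫ u in a..b, 1 / (u - 1) = Real.log ((b - 1) / (a - 1)) := by
    rw [← integral_one_div h0]
    exact intervalIntegral.integral_comp_sub_right (fun u : ℝ => 1 / u) 1
  rw [← e2, ← intervalIntegral.integral_add (hreg_int a b)]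
  · refine intervalIntegral.integral_congr_ae (Eventually.of_forall fun u hu => ?_)
    rw [Set.uIoc_of_le hab] at hu
    have : 0 < u := lt_of_le_of_lt ha hu.1
    simp [hreg, this]
  · apply ContinuousOn.intervalIntegrable
    refine ContinuousOn.div continuousOn_const (by fun_prop) fun u hu => ?_
    intro h
    exact h1 (by rwa [show (1:ℝ) = u by linarith])

lemma li_tendsto (x : ℝ) (hx : 1 < x) :
    Tendsto (fun ε : ℝ =>
      (∫ u in (0:ℝ)..(1 - ε), 1 / Real.log u) + ∫ u in (1 + ε)..x, 1 / Real.log u)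
      (nhdsWithin (0:ℝ) (Set.Ioi 0))
      (nhds ((∫ u in (0:ℝ)..1, hreg u) + (∫ u in (1:ℝ)..x, hreg u) + Real.log (x - 1))) := by
  have hc0 := intervalIntegral.continuous_primitive hreg_int 0
  have hc1 := intervalIntegral.continuous_primitive hreg_int x
  have hc : Continuous (fun ε : ℝ => (∫ u in (0:ℝ)..(1 - ε), hreg u)
      + (-∫ u in x..(1 + ε), hreg u) + Real.log (x - 1)) := by
    have h1 : Continuous (fun ε : ℝ => ∫ u in (0:ℝ)..(1 - ε), hreg u) :=
      hc0.comp (continuous_const.sub continuous_id)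
    have h2 : Continuous (fun ε : ℝ => ∫ u in x..(1 + ε), hreg u) :=
      hc1.comp (continuous_const.add continuous_id)
    exact (h1.add h2.neg).add continuous_const
  have ht := (hc.tendsto 0).mono_left (nhdsWithin_le_nhds (s := Set.Ioi 0))
  have e : (∫ u in (0:ℝ)..1, hreg u) + (∫ u in (1:ℝ)..x, hreg u) + Real.log (x - 1)
      = (∫ u in (0:ℝ)..(1 - 0), hreg u)
      + (-∫ u in x..(1 + 0), hreg u) + Real.log (x - 1) := by
    rw [← intervalIntegral.integral_symm]; simp
  rw [e]
  refine ht.congr' ?_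
  have hm : Set.Ioo (0:ℝ) (min 1 (x - 1)) ∈ nhdsWithin (0:ℝ) (Set.Ioi 0) :=
    Ioo_mem_nhdsGT (lt_min one_pos (by linarith))
  filter_upwards [hm] with ε hε
  have he0 := hε.1
  have he1 := lt_of_lt_of_le hε.2 (min_le_left _ _)
  have he2 := lt_of_lt_of_le hε.2 (min_le_right _ _)
  rw [integral_recip_log le_rfl (by linarith)
      (by rw [Set.uIcc_of_le (by linarith)]; intro h; linarith [h.2]),
    integral_recip_log (by linarith) (by linarith)
      (by rw [Set.uIcc_of_le (by linarith)]; intro h; linarith [h.1])]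
  rw [← intervalIntegral.integral_symm]
  have a1 : (1 - ε - 1) / (0 - 1) = ε := by ring
  have a2 : (x - 1) / (1 + ε - 1) = (x - 1) / ε := by ring
  rw [a1, a2, Real.log_div (by linarith) he0.ne']
  ring

lemma li_eq (x : ℝ) (hx : 1 < x) :
    li x = (∫ u in (0:ℝ)..1, hreg u) + (∫ u in (1:ℝ)..x, hreg u) + Real.log (x - 1) :=
  (li_tendsto x hx).limUnder_eq

lemma li_sub {a x : ℝ} (ha : 1 < a) (hx : a ≤ x) :
    li x - li a = ∫ u in a..x, 1 / Real.log u := by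
  rw [li_eq x (by linarith), li_eq a ha, integral_recip_log (by linarith) hx
    (by rw [Set.uIcc_of_le hx]; intro h; linarith [h.1]),
    Real.log_div (by linarith) (by linarith),
    ← intervalIntegral.integral_add_adjacent_intervals (hreg_int 1 a) (hreg_int a x)]
  ring

lemma psi_eq_zero_sum (x : ℝ) :
    ∑ n ∈ Finset.Icc 0 ⌊x⌋₊, ArithmeticFunction.vonMangoldt n = psi x := by
  unfold psi
  rw [← Finset.add_sum_Ioc_eq_sum_Icc (Nat.zero_le _)]
  simp only [ArithmeticFunction.map_zero, zero_add]
  rfl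

lemma term_eq (n : ℕ) :
    (if IsPrimePow n then (1 : ℝ) / (n.factorization n.minFac) else 0)
      = 1 / Real.log n * ArithmeticFunction.vonMangoldt n := by
  rw [ArithmeticFunction.vonMangoldt_apply]
  split_ifs with h
  · have e := h.minFac_pow_factorization_eq
    have hp : n.minFac.Prime := Nat.minFac_prime h.ne_one
    have hl : 0 < Real.log n.minFac := Real.log_pos (by exact_mod_cast hp.one_lt)
    have e2 : Real.log n = n.factorization n.minFac * Real.log n.minFac := by
      conv_lhs => rw [← e]
      push_cast
      rw [Real.log_pow]
    rw [e2]
    field_simp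
  · simp

lemma psi_mono' : Monotone psi := by
  intro a b hab
  unfold psi
  exact Finset.sum_le_sum_of_subset_of_nonneg
    (Finset.Icc_subset_Icc le_rfl (Nat.floor_le_floor hab))
    (fun _ _ _ => ArithmeticFunction.vonMangoldt_nonneg)

lemma R_int (a b : ℝ) : IntervalIntegrable R volume a b :=
  (psi_mono'.intervalIntegrable).sub (continuous_id.intervalIntegrable a b)

lemma R_right {t : ℝ} (ht : 0 ≤ t) : ContinuousWithinAt R (Set.Ioi t) t := by
  unfold R
  refine ContinuousWithinAt.sub ?_ continuousWithinAt_id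
  refine (continuousWithinAt_const (b := psi t)).congr_of_eventuallyEq ?_ rfl
  filter_upwards [Ioo_mem_nhdsGT (Nat.lt_floor_add_one t)] with s hs
  have : ⌊s⌋₊ = ⌊t⌋₊ := by
    rw [Nat.floor_eq_iff (ht.trans hs.1.le)]
    exact ⟨(Nat.floor_le ht).trans hs.1.le, hs.2⟩
  simp only [psi, this]

lemma R1_deriv {t : ℝ} (ht : 0 ≤ t) : HasDerivWithinAt R1 (R t) (Set.Ioi t) t := by
  have := intervalIntegral.integral_hasDerivWithinAt_right (s := Set.Ici t) (t := Set.Ioi t)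
    (R_int 2 t) ?_ (R_right ht)
  · exact this.mono Set.Ioi_subset_Ici_self
  · have hm : Measurable R := psi_mono'.measurable.sub measurable_id
    exact hm.stronglyMeasurable.aestronglyMeasurable.stronglyMeasurableAtFilter

lemma deriv_invlog {t : ℝ} (ht : 1 < t) :
    HasDerivAt (fun t => 1 / Real.log t) (-(1 / (t * Real.log t ^ 2))) t := by
  have hl := Real.log_pos ht
  have h := (Real.hasDerivAt_log (by linarith : t ≠ 0)).inv hl.ne'
  simp only [one_div]
  refine h.congr_deriv ?_
  field_simp

lemma deriv_w {t : ℝ} (ht : 1 < t) :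
    HasDerivAt (fun t => 1 / (t * Real.log t ^ 2))
      (-(1 / (t ^ 2 * Real.log t ^ 2) + 2 / (t ^ 2 * Real.log t ^ 3))) t := by
  have hl := Real.log_pos ht
  have h0 : (0:ℝ) < t := by linarith
  have h := (((hasDerivAt_id t).mul ((Real.hasDerivAt_log h0.ne').pow 2))).inv
    (by
      have : t * Real.log t ^ 2 ≠ 0 := by positivity
      simpa using this)
  simp only [one_div]
  refine h.congr_deriv ?_
  simp
  field_simp
  try ring

lemma deriv_tlog {t : ℝ} (ht : 1 < t) :
    HasDerivAt (fun t => t / Real.log t) (1 / Real.log t - 1 / Real.log t ^ 2) t := by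
  have hl := Real.log_pos ht
  have h0 : (0:ℝ) < t := by linarith
  refine ((hasDerivAt_id t).div (Real.hasDerivAt_log h0.ne') hl.ne').congr_deriv ?_
  simp
  field_simp

lemma cont_log {a x : ℝ} (ha : 1 < a) :
    ContinuousOn Real.log (Set.Icc a x) :=
  Real.continuousOn_log.mono fun t ht => by
    simp; linarith [ht.1]

lemma PiR_sub {a x : ℝ} (ha : 1 < a) (hx : a ≤ x) :
    PiR x - PiR a = psi x / Real.log x - psi a / Real.log a
      + ∫ t in a..x, 1 / (t * Real.log t ^ 2) * psi t := by
  have hd : ∀ t ∈ Set.Icc a x, deriv (fun t => 1 / Real.log t) t = -(1 / (t * Real.log t ^ 2)) :=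
    fun t ht => (deriv_invlog (lt_of_lt_of_le ha ht.1)).deriv
  have hab := sum_mul_eq_sub_sub_integral_mul (fun n => ArithmeticFunction.vonMangoldt n)
    (f := fun t => 1 / Real.log t) (a := a) (b := x) (by linarith) hx
    (fun t ht => (deriv_invlog (lt_of_lt_of_le ha ht.1)).differentiableAt) (by
      refine IntegrableOn.congr_fun (f := fun t => -(1 / (t * Real.log t ^ 2))) ?_
        (fun t ht => (hd t ht).symm) measurableSet_Icc
      refine ContinuousOn.integrableOn_Icc ?_
      exact fun t ht => (deriv_w (lt_of_lt_of_le ha ht.1)).continuousAt.continuousWithinAt.neg)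
  simp only [psi_eq_zero_sum] at hab
  have hP : PiR x - PiR a = ∑ k ∈ Finset.Ioc ⌊a⌋₊ ⌊x⌋₊,
      1 / Real.log k * ArithmeticFunction.vonMangoldt k := by
    unfold PiR
    simp only [term_eq]
    have hf : ∀ n : ℕ, Finset.Icc 1 n = Finset.Ioc 0 n := fun n => rfl
    rw [hf, hf, sub_eq_iff_eq_add', Finset.sum_Ioc_consecutive _ (Nat.zero_le _)
      (Nat.floor_le_floor hx)]
  rw [hP, hab, ← intervalIntegral.integral_of_le hx]
  have hi : ∫ t in a..x, deriv (fun t => 1 / Real.log t) t * psi t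
      = -∫ t in a..x, 1 / (t * Real.log t ^ 2) * psi t := by
    rw [← intervalIntegral.integral_neg]
    refine intervalIntegral.integral_congr fun t ht => ?_
    rw [Set.uIcc_of_le hx] at ht
    simp only [hd t ht]; ring
  rw [hi]; ring

lemma recip_log_int {a x : ℝ} (ha : 1 < a) (hx : a ≤ x) :
    ∫ t in a..x, 1 / Real.log t = x / Real.log x - a / Real.log a
      + ∫ t in a..x, 1 / Real.log t ^ 2 := by
  have c1 : IntervalIntegrable (fun t => 1 / Real.log t) volume a x := by
    apply ContinuousOn.intervalIntegrable
    rw [Set.uIcc_of_le hx]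
    exact continuousOn_const.div (cont_log ha)
      fun t ht => (Real.log_pos (lt_of_lt_of_le ha ht.1)).ne'
  have c2 : IntervalIntegrable (fun t => 1 / Real.log t ^ 2) volume a x := by
    apply ContinuousOn.intervalIntegrable
    rw [Set.uIcc_of_le hx]
    exact continuousOn_const.div ((cont_log ha).pow 2)
      fun t ht => pow_ne_zero 2 (Real.log_pos (lt_of_lt_of_le ha ht.1)).ne'
  have h := intervalIntegral.integral_eq_sub_of_hasDerivAt (a := a) (b := x)
    (f := fun t => t / Real.log t) (fun t ht => deriv_tlog (by
      rw [Set.uIcc_of_le hx] at ht; exact lt_of_lt_of_le ha ht.1)) (c1.sub c2)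
  rw [intervalIntegral.integral_sub c1 c2] at h
  linarith

lemma parts {a x : ℝ} (ha : 1 < a) (hx : a ≤ x) :
    ∫ t in a..x, 1 / (t * Real.log t ^ 2) * R t
      = R1 x / (x * Real.log x ^ 2) - R1 a / (a * Real.log a ^ 2)
      + ∫ t in a..x, (R1 t / (t ^ 2 * (Real.log t) ^ 2)
          + 2 * R1 t / (t ^ 2 * (Real.log t) ^ 3)) := by
  have hgt : ∀ t ∈ Set.uIcc a x, 1 < t := fun t ht => by
    rw [Set.uIcc_of_le hx] at ht; exact lt_of_lt_of_le ha ht.1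
  have hgt' : ∀ t ∈ Set.Ioo (min a x) (max a x), 1 < t := fun t ht => by
    rw [min_eq_left hx] at ht; exact ha.trans ht.1
  have cl : ContinuousOn Real.log (Set.uIcc a x) := by
    rw [Set.uIcc_of_le hx]; exact cont_log ha
  have h := intervalIntegral.integral_mul_deriv_eq_deriv_mul_of_hasDeriv_right
    (a := a) (b := x) (u := fun t => 1 / (t * Real.log t ^ 2)) (v := R1)
    (u' := fun t => -(1 / (t ^ 2 * Real.log t ^ 2) + 2 / (t ^ 2 * Real.log t ^ 3))) (v' := R)
    (fun t ht => (deriv_w (hgt t ht)).continuousAt.continuousWithinAt)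
    (intervalIntegral.continuous_primitive R_int 2).continuousOn
    (fun t ht => (deriv_w (hgt' t ht)).hasDerivWithinAt)
    (fun t ht => R1_deriv (by linarith [hgt' t ht]))
    (by
      apply ContinuousOn.intervalIntegrable
      have hne : ∀ t ∈ Set.uIcc a x, ∀ k : ℕ, t ^ 2 * Real.log t ^ k ≠ 0 := fun t ht k => by
        have h1 := hgt t ht
        have := Real.log_pos h1
        positivity
      exact ((continuousOn_const.div ((continuousOn_id.pow 2).mul (cl.pow 2))
        (fun t ht => hne t ht 2)).add (continuousOn_const.div
        ((continuousOn_id.pow 2).mul (cl.pow 3)) (fun t ht => hne t ht 3))).neg)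
    (R_int a x)
  rw [h]
  have e : ∫ t in a..x, -(1 / (t ^ 2 * Real.log t ^ 2) + 2 / (t ^ 2 * Real.log t ^ 3)) * R1 t
      = -∫ t in a..x, (R1 t / (t ^ 2 * (Real.log t) ^ 2)
          + 2 * R1 t / (t ^ 2 * (Real.log t) ^ 3)) := by
    rw [← intervalIntegral.integral_neg]
    congr 1; ext t; ring
  rw [e]; ring

lemma split_R {a x : ℝ} (ha : 1 < a) (hx : a ≤ x) :
    ∫ t in a..x, 1 / (t * Real.log t ^ 2) * R t
      = (∫ t in a..x, 1 / (t * Real.log t ^ 2) * psi t) - ∫ t in a..x, 1 / Real.log t ^ 2 := by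
  have hgt : ∀ t ∈ Set.uIcc a x, 1 < t := fun t ht => by
    rw [Set.uIcc_of_le hx] at ht; exact lt_of_lt_of_le ha ht.1
  have cw : ContinuousOn (fun t => 1 / (t * Real.log t ^ 2)) (Set.uIcc a x) :=
    fun t ht => (deriv_w (hgt t ht)).continuousAt.continuousWithinAt
  have c2 : IntervalIntegrable (fun t => 1 / Real.log t ^ 2) volume a x := by
    apply ContinuousOn.intervalIntegrable
    rw [Set.uIcc_of_le hx]
    exact continuousOn_const.div ((cont_log ha).pow 2)
      fun t ht => pow_ne_zero 2 (Real.log_pos (lt_of_lt_of_le ha ht.1)).ne'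
  rw [← intervalIntegral.integral_sub
    ((psi_mono'.intervalIntegrable).continuousOn_mul cw) c2]
  refine intervalIntegral.integral_congr fun t ht => ?_
  have h1 := hgt t ht
  have := Real.log_pos h1
  simp only [R]
  field_simp

theorem Q_eq (x : ℝ) (hx : 3000 ≤ x) :
    Q x = R x / Real.log x + R1 x / (x * (Real.log x) ^ 2)
      + (∫ t in (3000:ℝ)..x,
          (R1 t / (t ^ 2 * (Real.log t) ^ 2) + 2 * R1 t / (t ^ 2 * (Real.log t) ^ 3)))
      + Cconst := by
  have ha : (1:ℝ) < 3000 := by norm_num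
  have h1 := PiR_sub ha hx
  have h2 := li_sub ha hx
  have h3 := recip_log_int ha hx
  have h4 := parts ha hx
  have h5 := split_R ha hx
  unfold Cconst
  have e1 : R x / Real.log x = psi x / Real.log x - x / Real.log x := by simp only [R]; ring
  have e2 : R 3000 / Real.log 3000 = psi 3000 / Real.log 3000 - 3000 / Real.log 3000 := by
    simp only [R]; ring
  rw [e1, e2]
  simp only [Q]
  linarith
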